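/- Let p be a prime and n ∈ ℕ. Then the congruence b_{n+p}(x,λ) = b_{n+1}(x,λ) + (λ^p − λ + x^p) · b_n(x,λ) holds in the polynomial ring (ℤ/pℤ)[x,λ], where b_m(x,λ) denotes the weighted Bell polynomial with coefficients reduced modulo p. -/

import Mathlib

/-- Stirling numbers of the second kind. -/
def stirling2 : ℕ → ℕ → ℕ
  | 0, 0 => 1
  | 0, _ + 1 => 0
  | _ + 1, 0 => 0
  | n + 1, j + 1 => (j + 1) * stirling2 n (j + 1) + stirling2 n j

/-- Evaluation of the weighted Stirling number `R(n,j,λ) = ∑_m C(n,m) S(m,j) λ^{n-m}`. -/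
def wStirlingEval {R : Type*} [CommRing R] (n j : ℕ) (lam : R) : R :=
  ∑ m ∈ Finset.range (n + 1), (n.choose m : R) * (stirling2 m j : R) * lam ^ (n - m)

/-- Evaluation of the weighted Bell polynomial `b_n(x,λ) = ∑_j R(n,j,λ) x^j`. -/
def wBellEval {R : Type*} [CommRing R] (n : ℕ) (x lam : R) : R :=
  ∑ j ∈ Finset.range (n + 1), wStirlingEval n j lam * x ^ j

theorem stirling2_eq_zero_of_lt : ∀ {n j : ℕ}, n < j → stirling2 n j = 0
  | 0, _ + 1, _ => by rw [stirling2]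
  | n + 1, j + 1, h => by
    rw [stirling2, stirling2_eq_zero_of_lt (Nat.lt_of_succ_lt_succ h),
      stirling2_eq_zero_of_lt (Nat.lt_of_succ_lt h), mul_zero]

theorem stirling2_succ_succ_eq_sum_choose (n j : ℕ) :
    stirling2 (n + 1) (j + 1) = ∑ k ∈ Finset.range (n + 1), n.choose k * stirling2 k j := by
  induction n generalizing j with
  | zero => cases j <;> simp [stirling2]
  | succ n ih =>
    have key := Finset.sum_choose_succ_mul (R := ℕ) (fun i _ => stirling2 i j) n
    simp only [Nat.cast_id] at key
    rw [stirling2, key, ← ih j]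
    cases j with
    | zero => simp [stirling2]
    | succ j =>
      have expand : ∑ k ∈ Finset.range (n + 1), n.choose k * stirling2 (k + 1) (j + 1) =
          (j + 1) * stirling2 (n + 1) (j + 1 + 1) + stirling2 (n + 1) (j + 1) := by
        rw [ih j, ih (j + 1), Finset.mul_sum, ← Finset.sum_add_distrib]
        refine Finset.sum_congr rfl fun k _ => ?_
        rw [stirling2]
        ring
      rw [expand]
      ring

/-- The value at `x` of the Touchard polynomial `∑_j S(n,j) x^j`. -/
def touchardEval {R : Type*} [CommRing R] (x : R) (n : ℕ) : R :=
  ∑ j ∈ Finset.range (n + 1), (stirling2 n j : R) * x ^ j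

theorem touchardEval_eq_sum_range {R : Type*} [CommRing R] (x : R) {n N : ℕ} (h : n ≤ N) :
    touchardEval x n = ∑ j ∈ Finset.range (N + 1), (stirling2 n j : R) * x ^ j := by
  refine Finset.sum_subset (Finset.range_subset_range.2 (by lia)) fun j _ hj => ?_
  rw [stirling2_eq_zero_of_lt (by simpa using hj), Nat.cast_zero, zero_mul]

theorem touchardEval_succ {R : Type*} [CommRing R] (x : R) (n : ℕ) :
    touchardEval x (n + 1) =
      x * ∑ k ∈ Finset.range (n + 1), (n.choose k : R) * touchardEval x k := by
  have h : ∀ k ∈ Finset.range (n + 1), (n.choose k : R) * touchardEval x k =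
      ∑ j ∈ Finset.range (n + 1), (n.choose k : R) * ((stirling2 k j : R) * x ^ j) :=
    fun k hk => by
      rw [touchardEval_eq_sum_range x (Finset.mem_range_succ_iff.1 hk), Finset.mul_sum]
  rw [Finset.sum_congr rfl h, Finset.sum_comm, touchardEval, Finset.sum_range_succ', Finset.mul_sum]
  simp only [stirling2, Nat.cast_zero, zero_mul, add_zero]
  refine Finset.sum_congr rfl fun j _ => ?_
  have := stirling2_succ_succ_eq_sum_choose n j
  rw [stirling2] at this
  rw [this, Nat.cast_sum, Finset.sum_mul, Finset.mul_sum]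
  refine Finset.sum_congr rfl fun k _ => ?_
  push_cast
  ring

/-- The umbral functional sending `X ^ n` to the value at `x` of the `n`-th Touchard polynomial. -/
noncomputable def touchardFunctional {R : Type*} [CommRing R] (x : R) : Polynomial R →ₗ[R] R :=
  Polynomial.lsum fun n => LinearMap.mulRight R (touchardEval x n)

theorem touchardFunctional_X_pow {R : Type*} [CommRing R] (x : R) (n : ℕ) :
    touchardFunctional x (Polynomial.X ^ n) = touchardEval x n := by
  rw [← Polynomial.monomial_one_right_eq_X_pow]
  simp [touchardFunctional, Polynomial.lsum, Polynomial.sum_monomial_index]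

theorem touchardFunctional_C_mul {R : Type*} [CommRing R] (x a : R) (f : Polynomial R) :
    touchardFunctional x (Polynomial.C a * f) = a * touchardFunctional x f := by
  rw [← Polynomial.smul_eq_C_mul, map_smul, smul_eq_mul]

theorem touchardFunctional_X_mul {R : Type*} [CommRing R] (x : R) (f : Polynomial R) :
    touchardFunctional x (Polynomial.X * f) =
      x * touchardFunctional x (f.comp (Polynomial.X + 1)) := by
  induction f using Polynomial.induction_on' with
  | add f g hf hg => simp only [mul_add, Polynomial.add_comp, map_add, hf, hg]
  | monomial n a =>
    rw [← Polynomial.C_mul_X_pow_eq_monomial, mul_left_comm, ← pow_succ',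
      touchardFunctional_C_mul, touchardFunctional_X_pow, Polynomial.C_mul_comp,
      touchardFunctional_C_mul, Polynomial.X_pow_comp, add_pow, map_sum, touchardEval_succ,
      mul_left_comm]
    congr 2
    refine Finset.sum_congr rfl fun k _ => ?_
    rw [one_pow, mul_one, mul_comm (Polynomial.X ^ k), ← Polynomial.C_eq_natCast, touchardFunctional_C_mul,
      touchardFunctional_X_pow]

theorem touchardFunctional_descPochhammer_mul {R : Type*} [CommRing R] (x : R) (k : ℕ)
    (f : Polynomial R) :
    touchardFunctional x (descPochhammer R k * f) =
      x ^ k * touchardFunctional x (f.comp (Polynomial.X + (k : Polynomial R))) := by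
  induction k generalizing f with
  | zero => simp
  | succ k ih =>
    have h : ((descPochhammer R k).comp (Polynomial.X - 1)).comp (Polynomial.X + 1) =
        descPochhammer R k := by
      rw [Polynomial.comp_assoc]
      simp
    rw [descPochhammer_succ_left, mul_assoc, touchardFunctional_X_mul, Polynomial.mul_comp, h, ih,
      Polynomial.comp_assoc, ← mul_assoc, ← pow_succ']
    congr 3
    simp only [Polynomial.add_comp, Polynomial.X_comp, Polynomial.one_comp]
    push_cast
    ring

theorem descPochhammer_zmod_prime (p : ℕ) [Fact p.Prime] :
    descPochhammer (ZMod p) p = Polynomial.X ^ p - Polynomial.X := by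
  have hp : 1 < p := (Fact.out : p.Prime).one_lt
  have hmonic : (Polynomial.X ^ p - Polynomial.X : Polynomial (ZMod p)).Monic :=
    Polynomial.monic_X_pow_sub (by rw [Polynomial.degree_X]; exact_mod_cast hp)
  have hdeg : (descPochhammer (ZMod p) p).degree = p := by
    rw [Polynomial.degree_eq_natDegree (monic_descPochhammer _ p).ne_zero,
      descPochhammer_natDegree]
  have hdeg' : (Polynomial.X ^ p - Polynomial.X : Polynomial (ZMod p)).degree = p := by
    rw [Polynomial.degree_eq_natDegree hmonic.ne_zero,
      FiniteField.X_pow_card_sub_X_natDegree_eq _ hp]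
  refine Polynomial.eq_of_degree_sub_lt_of_eval_finset_eq Finset.univ ?_ fun a _ => ?_
  · rw [Finset.card_univ, ZMod.card, ← hdeg]
    refine Polynomial.degree_sub_lt_left (hdeg.trans hdeg'.symm) (monic_descPochhammer _ p).ne_zero ?_
    rw [(monic_descPochhammer _ p).leadingCoeff, hmonic.leadingCoeff]
  · rw [← ZMod.natCast_zmod_val a, descPochhammer_eval_coe_nat_of_lt (ZMod.val_lt a)]
    simp [ZMod.pow_card]

theorem descPochhammer_charP (R : Type*) [CommRing R] (p : ℕ) [Fact p.Prime] [CharP R p] :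
    descPochhammer R p = Polynomial.X ^ p - Polynomial.X := by
  rw [← descPochhammer_map (ZMod.castHom dvd_rfl R) p, descPochhammer_zmod_prime]
  simp

theorem wBellEval_eq_touchardFunctional {R : Type*} [CommRing R] (n : ℕ) (x lam : R) :
    wBellEval n x lam = touchardFunctional x ((Polynomial.X + Polynomial.C lam) ^ n) := by
  simp only [wBellEval, wStirlingEval, Finset.sum_mul]
  rw [Finset.sum_comm, add_pow, map_sum]
  refine Finset.sum_congr rfl fun m hm => ?_
  have h : (Polynomial.X ^ m * Polynomial.C lam ^ (n - m) * (n.choose m : Polynomial R)) =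
      Polynomial.C ((n.choose m : R) * lam ^ (n - m)) * Polynomial.X ^ m := by
    rw [Polynomial.C_mul, Polynomial.C_pow, Polynomial.C_eq_natCast]
    ring
  rw [h, touchardFunctional_C_mul, touchardFunctional_X_pow,
    touchardEval_eq_sum_range x (Finset.mem_range_succ_iff.1 hm), Finset.mul_sum]
  refine Finset.sum_congr rfl fun j _ => ?_
  ring

theorem wBellEval_add_prime {R : Type*} [CommRing R] (p : ℕ) [Fact p.Prime] [CharP R p] (n : ℕ)
    (x lam : R) :
    wBellEval (n + p) x lam =
      wBellEval (n + 1) x lam + (lam ^ p - lam + x ^ p) * wBellEval n x lam := by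
  simp only [wBellEval_eq_touchardFunctional]
  set q : Polynomial R := Polynomial.X + Polynomial.C lam with hq
  have hpow : q ^ (n + p) =
      q ^ (n + 1) + Polynomial.C (lam ^ p - lam) * q ^ n + descPochhammer R p * q ^ n := by
    rw [pow_add, pow_succ, descPochhammer_charP R p, Polynomial.C_sub, Polynomial.C_pow]
    have hqp : q ^ p = Polynomial.X ^ p + Polynomial.C lam ^ p := add_pow_char _ _ _
    rw [hqp, hq]
    ring
  rw [hpow, map_add, map_add, touchardFunctional_C_mul, touchardFunctional_descPochhammer_mul,
    CharP.cast_eq_zero, add_zero, Polynomial.comp_X]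
  ring

/-- The Touchard-type congruence for weighted Bell polynomials:
`b_{n+p}(x,λ) = b_{n+1}(x,λ) + (λ^p - λ + x^p) b_n(x,λ)` in `(ℤ/pℤ)[x,λ]`,
where `x = X 0` and `λ = X 1`. -/
theorem weighted_bell_touchard_congruence (p : ℕ) (hp : p.Prime) (n : ℕ) :
    wBellEval (n + p) (MvPolynomial.X 0 : MvPolynomial (Fin 2) (ZMod p)) (MvPolynomial.X 1) =
      wBellEval (n + 1) (MvPolynomial.X 0 : MvPolynomial (Fin 2) (ZMod p)) (MvPolynomial.X 1) +
        ((MvPolynomial.X 1 : MvPolynomial (Fin 2) (ZMod p)) ^ p - MvPolynomial.X 1 +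
            (MvPolynomial.X 0 : MvPolynomial (Fin 2) (ZMod p)) ^ p) *
          wBellEval n (MvPolynomial.X 0 : MvPolynomial (Fin 2) (ZMod p)) (MvPolynomial.X 1) := by
  have := Fact.mk hp
  exact wBellEval_add_prime p n _ _
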